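/- Let r and s be duplicate-free TP relations over the same fact type. For every fact f and time point t such that λ^{r,f}_t ≠ null or λ^{s,f}_t ≠ null, there exists exactly one window w ∈ W(r,s) with w.F = f and t ∈ w.T, and this window satisfies w.λr = λ^{r,f}_t and w.λs = λ^{s,f}_t. Consequently, distinct windows of W(r,s) with the same fact have disjoint time intervals. -/

import Mathlib

/-- Boolean lineage formulas over a type `V` of tuple identifiers. -/
inductive LineageExpr (V : Type) : Type where
  | var : V → LineageExpr V
  | not : LineageExpr V → LineageExpr V
  | and : LineageExpr V → LineageExpr V → LineageExpr V
  | or  : LineageExpr V → LineageExpr V → LineageExpr V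

/-- A TP tuple: a fact, a lineage expression and a half-open time interval `[ts, te)`. -/
structure TPTuple (F V : Type) where
  fact : F
  lam : LineageExpr V
  ts : ℕ
  te : ℕ

/-- Time point `t` belongs to the interval of tuple `u`. -/
def TPTuple.memT {F V : Type} (t : ℕ) (u : TPTuple F V) : Prop :=
  u.ts ≤ t ∧ t < u.te

/-- All tuples of the relation have nonempty intervals (`Ts < Te`). -/
def WF {F V : Type} (r : Set (TPTuple F V)) : Prop :=
  ∀ u ∈ r, u.ts < u.te

/-- A TP relation is duplicate-free iff any two distinct tuples have
different facts or disjoint time intervals. -/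
def DupFree {F V : Type} (r : Set (TPTuple F V)) : Prop :=
  ∀ u ∈ r, ∀ u' ∈ r, u ≠ u' →
    u.fact ≠ u'.fact ∨ ∀ t : ℕ, ¬ (TPTuple.memT t u ∧ TPTuple.memT t u')

open Classical in
/-- `lamAt r f t` = the lineage `λ^{r,f}_t` of the (for duplicate-free `r`, unique)
tuple of `r` with fact `f` whose interval contains `t`; `none` if no such tuple exists. -/
noncomputable def lamAt {F V : Type} (r : Set (TPTuple F V)) (f : F) (t : ℕ) :
    Option (LineageExpr V) :=
  if h : ∃ u, u ∈ r ∧ u.fact = f ∧ u.ts ≤ t ∧ t < u.te then some h.choose.lam else none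
/-- A lineage-aware temporal window: a fact, a time interval and the pair of
(possibly null) lineages of the valid tuples of the two input relations. -/
structure Window (F V : Type) where
  fact : F
  ts : ℕ
  te : ℕ
  lamr : Option (LineageExpr V)
  lams : Option (LineageExpr V)

/-- Membership in the set of lineage-aware temporal windows `W(r,s)`. -/
def IsWindow {F V : Type} (r s : Set (TPTuple F V)) (w : Window F V) : Prop :=
  w.ts < w.te ∧
  (∀ t : ℕ, w.ts ≤ t → t < w.te →
    (lamAt r w.fact t ≠ none ∨ lamAt s w.fact t ≠ none) ∧
    lamAt r w.fact t = w.lamr ∧ lamAt s w.fact t = w.lams) ∧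
  (w.ts = 0 ∨
    ¬ (lamAt r w.fact (w.ts - 1) = w.lamr ∧ lamAt s w.fact (w.ts - 1) = w.lams)) ∧
  ¬ (lamAt r w.fact w.te = w.lamr ∧ lamAt s w.fact w.te = w.lams)

/-- A finite TP relation has no valid tuples from some time point on. -/
lemma exists_forall_ge_lamAt_eq_none {F V : Type} {r : Set (TPTuple F V)} (hr : r.Finite) :
    ∃ b, ∀ f t, b ≤ t → lamAt r f t = none := by
  obtain ⟨b, hb⟩ := (hr.image TPTuple.te).bddAbove
  refine ⟨b, fun f t ht => dif_neg ?_⟩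
  rintro ⟨u, hu, -, -, htu⟩
  exact absurd (hb (Set.mem_image_of_mem _ hu)) (by omega)

/-- If a predicate on the naturals holds at `t` and fails at some later point, then `t` lies in
a maximal half-open interval on which it holds. -/
lemma exists_maximal_interval {p : ℕ → Prop} {t b : ℕ} (ht : p t) (htb : t ≤ b) (hb : ¬ p b) :
    ∃ x y, x ≤ t ∧ t < y ∧ (∀ i, x ≤ i → i < y → p i) ∧ (x = 0 ∨ ¬ p (x - 1)) ∧ ¬ p y := by
  classical
  have hy : ∃ y, t ≤ y ∧ ¬ p y := ⟨b, htb, hb⟩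
  have hx : ∃ x, x ≤ t ∧ ∀ i, x ≤ i → i ≤ t → p i :=
    ⟨t, le_rfl, fun i h₁ h₂ => le_antisymm h₁ h₂ ▸ ht⟩
  obtain ⟨hty, hpy⟩ := Nat.find_spec hy
  obtain ⟨hxt, hpx⟩ := Nat.find_spec hx
  refine ⟨Nat.find hx, Nat.find hy, hxt, lt_of_le_of_ne hty fun h => hpy (h ▸ ht),
    fun i hxi hiy => ?_, ?_, hpy⟩
  · rcases le_total i t with h | h
    · exact hpx i hxi h
    · by_contra hpi
      exact Nat.find_min hy hiy ⟨h, hpi⟩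
  · by_contra! h
    refine Nat.find_min hx (Nat.sub_one_lt h.1) ⟨by omega, fun i h₁ h₂ => ?_⟩
    rcases eq_or_lt_of_le h₁ with h₃ | h₃
    · exact h₃ ▸ h.2
    · exact hpx i (by omega) h₂

/-- Two windows with the same fact that share a time point coincide. -/
lemma IsWindow.eq_of_mem {F V : Type} {r s : Set (TPTuple F V)} {w w' : Window F V}
    (hw : IsWindow r s w) (hw' : IsWindow r s w') (hf : w.fact = w'.fact) {t : ℕ}
    (ht : w.ts ≤ t ∧ t < w.te) (ht' : w'.ts ≤ t ∧ t < w'.te) : w = w' := by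
  obtain ⟨f, x, y, lr, ls⟩ := w
  obtain ⟨f', x', y', lr', ls'⟩ := w'
  obtain ⟨-, h, hl, hu⟩ := hw
  obtain ⟨-, h', hl', hu'⟩ := hw'
  dsimp only at *
  subst hf
  obtain ⟨-, rfl, rfl⟩ := h t ht.1 ht.2
  obtain ⟨-, hlr, hls⟩ := h' t ht'.1 ht'.2
  rw [← hlr, ← hls] at h' hl' hu' ⊢
  have hx : x = x' := by
    rcases lt_trichotomy x x' with hlt | heq | hlt
    · exact absurd (h (x' - 1) (by omega) (by omega)).2 (hl'.resolve_left (by omega))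
    · exact heq
    · exact absurd (h' (x - 1) (by omega) (by omega)).2 (hl.resolve_left (by omega))
  have hy : y = y' := by
    rcases lt_trichotomy y y' with hlt | heq | hlt
    · exact absurd (h' y (by omega) hlt).2 hu
    · exact heq
    · exact absurd (h y' (by omega) hlt).2 hu'
  rw [hx, hy]

/-- Every time point with a valid tuple in one of two finite TP relations lies in a window. -/
lemma exists_isWindow_mem {F V : Type} {r s : Set (TPTuple F V)} (hr : r.Finite)
    (hs : s.Finite) {f : F} {t : ℕ} (ht : lamAt r f t ≠ none ∨ lamAt s f t ≠ none) :
    ∃ w : Window F V, IsWindow r s w ∧ w.fact = f ∧ w.ts ≤ t ∧ t < w.te := by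
  obtain ⟨b, hb⟩ := exists_forall_ge_lamAt_eq_none hr
  obtain ⟨c, hc⟩ := exists_forall_ge_lamAt_eq_none hs
  obtain ⟨x, y, hxt, hty, h, hx, hy⟩ := exists_maximal_interval
    (p := fun i => lamAt r f i = lamAt r f t ∧ lamAt s f i = lamAt s f t)
    (t := t) (b := max t (max b c)) ⟨rfl, rfl⟩ (le_max_left _ _) (by
      rw [hb f _ (by omega), hc f _ (by omega)]
      rintro ⟨h₁, h₂⟩
      exact ht.elim (fun h => h h₁.symm) fun h => h h₂.symm)
  refine ⟨⟨f, x, y, lamAt r f t, lamAt s f t⟩,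
    ⟨hxt.trans_lt hty, fun i h₁ h₂ => ⟨?_, h i h₁ h₂⟩, hx, hy⟩, rfl, hxt, hty⟩
  rwa [(h i h₁ h₂).1, (h i h₁ h₂).2]

/-- For duplicate-free TP relations `r` and `s`: for every fact
`f` and time point `t` with `λ^{r,f}_t ≠ null` or `λ^{s,f}_t ≠ null`, there is
exactly one window `w ∈ W(r,s)` with `w.F = f` and `t ∈ w.T`, and this window
satisfies `w.λr = λ^{r,f}_t` and `w.λs = λ^{s,f}_t`. Consequently, distinct
windows of `W(r,s)` with the same fact have disjoint time intervals. -/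
theorem tp_windows_partition {F V : Type}
    (r s : Set (TPTuple F V)) (hrfin : r.Finite) (hsfin : s.Finite)
    (hrWF : WF r) (hsWF : WF s) (hrDF : DupFree r) (hsDF : DupFree s) :
    (∀ (f : F) (t : ℕ), (lamAt r f t ≠ none ∨ lamAt s f t ≠ none) →
      (∃! w : Window F V, IsWindow r s w ∧ w.fact = f ∧ w.ts ≤ t ∧ t < w.te) ∧
      (∀ w : Window F V, IsWindow r s w → w.fact = f → w.ts ≤ t → t < w.te →
        w.lamr = lamAt r f t ∧ w.lams = lamAt s f t)) ∧
    (∀ w w' : Window F V, IsWindow r s w → IsWindow r s w' →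
      w.fact = w'.fact → w ≠ w' →
      ∀ t : ℕ, ¬ ((w.ts ≤ t ∧ t < w.te) ∧ (w'.ts ≤ t ∧ t < w'.te))) := by
  refine ⟨fun f t ht => ⟨?_, ?_⟩, fun w w' hw hw' hf hne t ht =>
    hne (hw.eq_of_mem hw' hf ht.1 ht.2)⟩
  · obtain ⟨w, hw, hf, hwt⟩ := exists_isWindow_mem hrfin hsfin ht
    exact ⟨w, ⟨hw, hf, hwt⟩, fun w' ⟨hw', hf', hwt'⟩ =>
      hw'.eq_of_mem hw (hf'.trans hf.symm) hwt' hwt⟩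
  · rintro w hw rfl h₁ h₂
    obtain ⟨-, hr, hs⟩ := hw.2.1 t h₁ h₂
    exact ⟨hr.symm, hs.symm⟩
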